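/- arXiv:1403.1708 — 3 statements merged into one kernel-verified Lean document; each statement's English description precedes it below -/
import Mathlib

section
/- For all real numbers t ≥ t' > 0, √(t+t') − √(t−t') = (2 / B(3/4, 3/4)) ∫₀^{t'} u^{1/2} (t² − u²)^{−1/4} (t'² − u²)^{−1/4} du, where B denotes the Euler beta function. Consequently, the Gaussian process r with covariance E(r(t) r(t')) = √(t+t') − √(t−t') admits the representation r(t) = c ∫₀^t ( s^{1/4} / (t² − s²)^{1/4} ) db(s) with b a standard Brownian motion and c = ( (1/2) B(3/4, 3/4) )^{−1/2}. -/
open MeasureTheory Real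

/-- Euler beta function `B(a,b) = Γ(a)Γ(b)/Γ(a+b)`. -/
noncomputable def eulerBeta (a b : ℝ) : ℝ :=
  Real.Gamma a * Real.Gamma b / Real.Gamma (a + b)

/-- The Itô-isometry covariance of the stochastic integral
`c ∫₀^t (s^{1/4}/(t²−s²)^{1/4}) db(s)` with `c = ((1/2) B(3/4,3/4))^{−1/2}`: for `t ≥ t'`
it equals `c² ∫₀^{t'} u^{1/2} (t²−u²)^{−1/4} (t'²−u²)^{−1/4} du`. -/
noncomputable def itoCov (t t' : ℝ) : ℝ :=
  ((1 / 2 * eulerBeta (3 / 4) (3 / 4)) ^ (-(1 : ℝ) / 2)) ^ 2 *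
    ∫ u in (0 : ℝ)..t',
      u ^ ((1 : ℝ) / 2) * (t ^ 2 - u ^ 2) ^ (-(1 / 4) : ℝ) * (t' ^ 2 - u ^ 2) ^ (-(1 / 4) : ℝ)

theorem Ring.succ_mul_choose_succ (a : ℝ) (n : ℕ) :
    ((n : ℝ) + 1) * Ring.choose a (n + 1) = (a - n) * Ring.choose a n := by
  have h0 := Ring.descPochhammer_eq_factorial_smul_choose a n
  have h1 := Ring.descPochhammer_eq_factorial_smul_choose a (n + 1)
  rw [descPochhammer_succ_right, Polynomial.smeval_mul, h0, Polynomial.smeval_sub,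
    Polynomial.smeval_X, Polynomial.smeval_natCast, Nat.factorial_succ] at h1
  simp only [nsmul_eq_mul, pow_one, pow_zero, mul_one] at h1
  have hn : (n.factorial : ℝ) ≠ 0 := by positivity
  apply mul_left_cancel₀ hn
  push_cast at h1
  linear_combination -h1

theorem Real.hasSum_choose_mul_pow (a : ℝ) {x : ℝ} (hx : |x| < 1) :
    HasSum (fun n : ℕ => Ring.choose a n * x ^ n) ((1 + x) ^ a) := by
  have h := (Real.one_add_rpow_hasFPowerSeriesOnBall_zero (a := a)).hasSum (y := x)
    (by simpa [enorm_eq_nnnorm, ← NNReal.coe_lt_coe] using hx)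
  simpa only [binomialSeries_apply, List.ofFn_const, List.prod_replicate, smul_eq_mul, zero_add]
    using h

theorem Real.hasSum_sqrt_one_add_sub_sqrt_one_sub {x : ℝ} (hx : |x| < 1) :
    HasSum (fun n : ℕ => 2 * Ring.choose (1 / 2 : ℝ) (2 * n + 1) * x ^ (2 * n + 1))
      (√(1 + x) - √(1 - x)) := by
  have h := (Real.hasSum_choose_mul_pow (1 / 2) hx).sub
    (Real.hasSum_choose_mul_pow (1 / 2) (x := -x) (by rwa [abs_neg]))
  rw [← Real.sqrt_eq_rpow, ← sub_eq_add_neg, ← Real.sqrt_eq_rpow] at h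
  have hinj : Function.Injective fun n : ℕ => 2 * n + 1 := fun a b hab => by
    simpa using hab
  rw [← hinj.hasSum_iff] at h
  · convert! h using 2 with n
    simp only [Function.comp, Odd.neg_pow (odd_two_mul_add_one n)]
    ring
  · intro n hn
    have he : Even n := by
      by_contra ho
      obtain ⟨k, rfl⟩ := Nat.not_even_iff_odd.mp ho
      exact hn ⟨k, rfl⟩
    simp [he.neg_pow]

theorem eulerBeta_pos {a b : ℝ} (ha : 0 < a) (hb : 0 < b) : 0 < eulerBeta a b :=
  ProbabilityTheory.beta_pos ha hb

theorem integral_rpow_mul_one_sub_rpow {a b : ℝ} (ha : 0 < a) (hb : 0 < b) :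
    ∫ v in Set.Ioo (0 : ℝ) 1, v ^ (a - 1) * (1 - v) ^ (b - 1) = eulerBeta a b := by
  have h : (eulerBeta a b : ℂ) = Complex.betaIntegral a b := by
    rw [Complex.betaIntegral_eq_Gamma_mul_div _ _ (by simpa) (by simpa), ← Complex.ofReal_add]
    simp only [Complex.Gamma_ofReal, eulerBeta]
    norm_cast
  rw [Complex.betaIntegral, intervalIntegral.integral_of_le zero_le_one,
    integral_Ioc_eq_integral_Ioo] at h
  apply Complex.ofReal_injective
  rw [h, ← integral_complex_ofReal]
  refine setIntegral_congr_fun measurableSet_Ioo fun v hv => ?_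
  have h1 : 0 ≤ 1 - v := by linarith [hv.2]
  simp only [Complex.ofReal_mul, Complex.ofReal_cpow hv.1.le, Complex.ofReal_cpow h1,
    Complex.ofReal_sub, Complex.ofReal_one]

theorem integrableOn_rpow_mul_one_sub_rpow {a b : ℝ} (ha : 0 < a) (hb : 0 < b) :
    IntegrableOn (fun v : ℝ => v ^ (a - 1) * (1 - v) ^ (b - 1)) (Set.Ioo 0 1) := by
  by_contra h
  have := integral_rpow_mul_one_sub_rpow ha hb
  rw [integral_undef h] at this
  exact (eulerBeta_pos ha hb).ne this

theorem choose_mul_eulerBeta (n : ℕ) :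
    (-1) ^ n * Ring.choose (-(1 / 4) : ℝ) n * eulerBeta (n + 3 / 4) (3 / 4) =
      eulerBeta (3 / 4) (3 / 4) * (2 * Ring.choose (1 / 2 : ℝ) (2 * n + 1)) := by
  induction n with
  | zero => simp
  | succ n ih =>
    have hB : eulerBeta ((n + 1 : ℕ) + 3 / 4) (3 / 4) =
        (n + 3 / 4) / (n + 3 / 2) * eulerBeta (n + 3 / 4) (3 / 4) := by
      have h1 : Real.Gamma (n + 3 / 2) ≠ 0 := (Real.Gamma_pos_of_pos (by positivity)).ne'
      simp only [eulerBeta]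
      rw [show ((n + 1 : ℕ) + 3 / 4 : ℝ) + 3 / 4 = (n + 3 / 2) + 1 by push_cast; ring,
        show ((n + 1 : ℕ) + 3 / 4 : ℝ) = (n + 3 / 4) + 1 by push_cast; ring,
        show (n + 3 / 4 : ℝ) + 3 / 4 = n + 3 / 2 by ring,
        Real.Gamma_add_one (by positivity), Real.Gamma_add_one (by positivity)]
      field_simp
    have h1 := Ring.succ_mul_choose_succ (-(1 / 4)) n
    have h2 := Ring.succ_mul_choose_succ (1 / 2) (2 * n + 1)
    have h3 := Ring.succ_mul_choose_succ (1 / 2) (2 * n + 1 + 1)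
    push_cast at h2 h3
    have e1 : Ring.choose (-(1 / 4) : ℝ) (n + 1) =
        (-(1 / 4) - n) / (n + 1) * Ring.choose (-(1 / 4) : ℝ) n := by
      field_simp at h1 ⊢; linear_combination h1
    have e2 : Ring.choose (1 / 2 : ℝ) (2 * n + 1 + 1) =
        (1 / 2 - (2 * n + 1)) / (2 * n + 1 + 1) * Ring.choose (1 / 2 : ℝ) (2 * n + 1) := by
      field_simp at h2 ⊢; linear_combination h2
    have e3 : Ring.choose (1 / 2 : ℝ) (2 * (n + 1) + 1) =
        (1 / 2 - (2 * n + 1 + 1)) / (2 * n + 1 + 1 + 1) *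
          Ring.choose (1 / 2 : ℝ) (2 * n + 1 + 1) := by
      rw [show 2 * (n + 1) + 1 = 2 * n + 1 + 1 + 1 by ring]
      field_simp at h3 ⊢; linear_combination h3
    rw [hB, e1, e3, e2]
    have key : (-1 : ℝ) * ((-(1 / 4) - n) / (n + 1)) * ((n + 3 / 4) / (n + 3 / 2)) =
        (1 / 2 - (2 * n + 1 + 1)) / (2 * n + 1 + 1 + 1) *
          ((1 / 2 - (2 * n + 1)) / (2 * n + 1 + 1)) := by
      field_simp; ring
    rw [pow_succ]
    linear_combination (-1 : ℝ) * ((-(1 / 4) - n) / (n + 1)) * ((n + 3 / 4) / (n + 3 / 2)) * ih +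
      eulerBeta (3 / 4) (3 / 4) * (2 * Ring.choose (1 / 2 : ℝ) (2 * n + 1)) * key

theorem neg_one_pow_mul_choose_neg_nonneg {a : ℝ} (ha : 0 ≤ a) (n : ℕ) :
    0 ≤ (-1) ^ n * Ring.choose (-a) n := by
  induction n with
  | zero => simp
  | succ n ih =>
    have h := Ring.succ_mul_choose_succ (-a) n
    have hn : (0 : ℝ) < n + 1 := by positivity
    refine le_of_mul_le_mul_left (a := (n : ℝ) + 1) ?_ hn
    have : ((n : ℝ) + 1) * ((-1) ^ (n + 1) * Ring.choose (-a) (n + 1)) =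
        (a + n) * ((-1) ^ n * Ring.choose (-a) n) := by
      rw [pow_succ]; linear_combination (-(-1) ^ n) * h
    rw [this, mul_zero]
    positivity

theorem mul_integral_eq_of_lt_one {x : ℝ} (hx0 : 0 < x) (hx1 : x < 1) :
    x * ∫ v in Set.Ioo (0 : ℝ) 1,
        v ^ (-(1 / 4) : ℝ) * (1 - v) ^ (-(1 / 4) : ℝ) * (1 - x ^ 2 * v) ^ (-(1 / 4) : ℝ) =
      eulerBeta (3 / 4) (3 / 4) * (√(1 + x) - √(1 - x)) := by
  have hx : |x| < 1 := by rwa [abs_of_pos hx0]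
  let c : ℕ → ℝ := fun n => (-1) ^ n * Ring.choose (-(1 / 4) : ℝ) n * x ^ (2 * n)
  have hc (n : ℕ) : 0 ≤ c n :=
    mul_nonneg (neg_one_pow_mul_choose_neg_nonneg (by norm_num) n) (by positivity)
  let F : ℕ → ℝ → ℝ := fun n v =>
    c n * (v ^ ((n + 3 / 4 : ℝ) - 1) * (1 - v) ^ ((3 / 4 : ℝ) - 1))
  have hF_int (n : ℕ) : Integrable (F n) (volume.restrict (Set.Ioo 0 1)) :=
    Integrable.const_mul
      (integrableOn_rpow_mul_one_sub_rpow (by positivity) (by norm_num)) (c n)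
  have hF_val (n : ℕ) : ∫ v in Set.Ioo (0 : ℝ) 1, F n v =
      c n * eulerBeta (n + 3 / 4) (3 / 4) := by
    rw [integral_const_mul, integral_rpow_mul_one_sub_rpow (by positivity) (by norm_num)]
  have hF_norm (n : ℕ) : ∫ v in Set.Ioo (0 : ℝ) 1, ‖F n v‖ =
      c n * eulerBeta (n + 3 / 4) (3 / 4) := by
    rw [← hF_val]
    refine setIntegral_congr_fun measurableSet_Ioo fun v hv => ?_
    have h1 : 0 ≤ 1 - v := by linarith [hv.2]
    exact Real.norm_of_nonneg (mul_nonneg (hc n)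
      (mul_nonneg (Real.rpow_nonneg hv.1.le _) (Real.rpow_nonneg h1 _)))
  have hsum : HasSum (fun n => c n * eulerBeta (n + 3 / 4) (3 / 4))
      (eulerBeta (3 / 4) (3 / 4) * (√(1 + x) - √(1 - x)) / x) := by
    convert! ((Real.hasSum_sqrt_one_add_sub_sqrt_one_sub hx).mul_left
      (eulerBeta (3 / 4) (3 / 4))).div_const x using 2 with n
    rw [eq_div_iff hx0.ne']
    linear_combination x ^ (2 * n + 1) * choose_mul_eulerBeta n
  have h := hasSum_integral_of_summable_integral_norm hF_int
    (by simpa only [hF_norm] using hsum.summable)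
  simp only [hF_val] at h
  have h' : ∫ v in Set.Ioo (0 : ℝ) 1, ∑' n, F n v = ∫ v in Set.Ioo (0 : ℝ) 1,
      v ^ (-(1 / 4) : ℝ) * (1 - v) ^ (-(1 / 4) : ℝ) * (1 - x ^ 2 * v) ^ (-(1 / 4) : ℝ) := by
    refine setIntegral_congr_fun measurableSet_Ioo fun v hv => ?_
    have hlt : |(-(x ^ 2 * v))| < 1 := by
      rw [abs_neg, abs_of_nonneg (by have := hv.1; positivity)]
      nlinarith [hv.1, hv.2]
    have hs := (Real.hasSum_choose_mul_pow (-(1 / 4)) hlt).mul_left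
      (v ^ (-(1 / 4) : ℝ) * (1 - v) ^ (-(1 / 4) : ℝ))
    rw [← sub_eq_add_neg] at hs
    rw [← hs.tsum_eq]
    refine tsum_congr fun n => ?_
    simp only [F, c]
    rw [show (n + 3 / 4 : ℝ) - 1 = -(1 / 4) + n by ring, Real.rpow_add_natCast hv.1.ne',
      show (3 / 4 : ℝ) - 1 = -(1 / 4) by norm_num, neg_pow (x ^ 2 * v), mul_pow, ← pow_mul]
    ring
  rw [← h', h.unique hsum]
  field_simp

theorem eulerBeta_three_quarters_half :
    eulerBeta (3 / 4) (1 / 2) = √2 * eulerBeta (3 / 4) (3 / 4) := by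
  have h1 : Real.Gamma (5 / 4) = 1 / 4 * Real.Gamma (1 / 4) := by
    rw [← Real.Gamma_add_one (by norm_num)]; norm_num
  have h2 : Real.Gamma (3 / 2) = 1 / 2 * √π := by
    rw [← Real.Gamma_one_half_eq, ← Real.Gamma_add_one (by norm_num)]; norm_num
  have h3 := Real.Gamma_mul_Gamma_one_sub (1 / 4)
  rw [show π * (1 / 4) = π / 4 by ring, Real.sin_pi_div_four,
    show (1 : ℝ) - 1 / 4 = 3 / 4 by norm_num] at h3
  have p1 : 0 < Real.Gamma (1 / 4) := Real.Gamma_pos_of_pos (by norm_num)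
  have p3 : 0 < Real.Gamma (3 / 4) := Real.Gamma_pos_of_pos (by norm_num)
  have hpi : √π ^ 2 = π := Real.sq_sqrt Real.pi_pos.le
  have hpi0 : 0 < √π := Real.sqrt_pos.mpr Real.pi_pos
  have h22 : √2 ^ 2 = (2 : ℝ) := Real.sq_sqrt (by norm_num)
  have h20 : 0 < √(2 : ℝ) := Real.sqrt_pos.mpr (by norm_num)
  simp only [eulerBeta]
  rw [show (3 / 4 : ℝ) + 1 / 2 = 5 / 4 by norm_num, show (3 / 4 : ℝ) + 3 / 4 = 3 / 2 by norm_num,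
    h1, h2, Real.Gamma_one_half_eq]
  field_simp at h3 ⊢
  rw [hpi]
  linear_combination -2 * h3

theorem mul_integral_eq {x : ℝ} (hx0 : 0 < x) (hx1 : x ≤ 1) :
    x * ∫ v in Set.Ioo (0 : ℝ) 1,
        v ^ (-(1 / 4) : ℝ) * (1 - v) ^ (-(1 / 4) : ℝ) * (1 - x ^ 2 * v) ^ (-(1 / 4) : ℝ) =
      eulerBeta (3 / 4) (3 / 4) * (√(1 + x) - √(1 - x)) := by
  rcases hx1.lt_or_eq with h | rfl
  · exact mul_integral_eq_of_lt_one hx0 h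
  · have h : ∫ v in Set.Ioo (0 : ℝ) 1,
        v ^ (-(1 / 4) : ℝ) * (1 - v) ^ (-(1 / 4) : ℝ) * (1 - 1 ^ 2 * v) ^ (-(1 / 4) : ℝ) =
        eulerBeta (3 / 4) (1 / 2) := by
      rw [← integral_rpow_mul_one_sub_rpow (by norm_num) (by norm_num)]
      refine setIntegral_congr_fun measurableSet_Ioo fun v hv => ?_
      have h1 : 0 < 1 - v := by linarith [hv.2]
      simp only [one_pow, one_mul]
      rw [mul_assoc, ← Real.rpow_add h1]
      norm_num
    rw [h, eulerBeta_three_quarters_half]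
    norm_num
    ring

theorem integral_sq_substitution {t t' : ℝ} (ht' : 0 < t') (htt : t' ≤ t) :
    ∫ u in (0 : ℝ)..t', u ^ ((1 : ℝ) / 2) * (t ^ 2 - u ^ 2) ^ (-(1 / 4) : ℝ) *
        (t' ^ 2 - u ^ 2) ^ (-(1 / 4) : ℝ) =
      t' / (2 * √t) * ∫ v in Set.Ioo (0 : ℝ) 1,
        v ^ (-(1 / 4) : ℝ) * (1 - v) ^ (-(1 / 4) : ℝ) *
          (1 - (t' / t) ^ 2 * v) ^ (-(1 / 4) : ℝ) := by
  have ht : 0 < t := ht'.trans_le htt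
  have himg : (fun u : ℝ => u ^ 2 / t' ^ 2) '' Set.Ioo 0 t' = Set.Ioo 0 1 := by
    ext v
    constructor
    · rintro ⟨u, ⟨h0, h1⟩, rfl⟩
      refine ⟨by positivity, ?_⟩
      rw [div_lt_one (by positivity)]
      gcongr
    · rintro ⟨h0, h1⟩
      refine ⟨t' * √v, ⟨by positivity, ?_⟩, ?_⟩
      · have : √v < 1 := by rw [Real.sqrt_lt' one_pos]; simpa
        nlinarith
      · simp only [mul_pow, Real.sq_sqrt h0.le]
        field_simp
  have hinj : Set.InjOn (fun u : ℝ => u ^ 2 / t' ^ 2) (Set.Ioo 0 t') := by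
    intro u hu w hw h
    have : u ^ 2 = w ^ 2 := by
      have := h
      simp only at this
      field_simp at this
      exact this
    exact (pow_left_inj₀ hu.1.le hw.1.le two_ne_zero).mp this
  have hder (u : ℝ) (_ : u ∈ Set.Ioo 0 t') :
      HasDerivWithinAt (fun u : ℝ => u ^ 2 / t' ^ 2) (2 * u / t' ^ 2) (Set.Ioo 0 t') u := by
    have := ((hasDerivAt_pow 2 u).div_const (t' ^ 2)).hasDerivWithinAt (s := Set.Ioo 0 t')
    simpa using this
  rw [← himg, integral_image_eq_integral_abs_deriv_smul measurableSet_Ioo hder hinj,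
    ← integral_const_mul, intervalIntegral.integral_of_le ht'.le, integral_Ioc_eq_integral_Ioo]
  refine setIntegral_congr_fun measurableSet_Ioo fun u hu => ?_
  have hu0 := hu.1
  have h1 : 0 ≤ t' ^ 2 - u ^ 2 := by nlinarith [hu.1, hu.2]
  have h2 : 0 ≤ t ^ 2 - u ^ 2 := by nlinarith [hu.1, hu.2]
  have hsq {y : ℝ} (hy : 0 < y) : (y ^ 2) ^ (-(1 / 4) : ℝ) = (√y)⁻¹ := by
    rw [← Real.rpow_natCast y 2, ← Real.rpow_mul hy.le, Real.sqrt_eq_rpow,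
      ← Real.rpow_neg hy.le]
    norm_num
  simp only [smul_eq_mul]
  rw [show 1 - u ^ 2 / t' ^ 2 = (t' ^ 2 - u ^ 2) / t' ^ 2 by field_simp,
    show 1 - (t' / t) ^ 2 * (u ^ 2 / t' ^ 2) = (t ^ 2 - u ^ 2) / t ^ 2 by field_simp,
    Real.div_rpow (by positivity) (by positivity), Real.div_rpow h1 (by positivity),
    Real.div_rpow h2 (by positivity), hsq hu0, hsq ht', hsq ht,
    abs_of_nonneg (by positivity), ← Real.sqrt_eq_rpow]
  have su : √u ^ 2 = u := Real.sq_sqrt hu0.le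
  have st' : √t' ^ 2 = t' := Real.sq_sqrt ht'.le
  have pu : 0 < √u := Real.sqrt_pos.mpr hu0
  have pt : 0 < √t := Real.sqrt_pos.mpr ht
  have pt' : 0 < √t' := Real.sqrt_pos.mpr ht'
  field_simp
  rw [su, st']
  ring

theorem sqrt_add_sub_sqrt_sub_eq {t t' : ℝ} (ht' : 0 < t') (htt : t' ≤ t) :
    √(t + t') - √(t - t') = (2 / eulerBeta (3 / 4) (3 / 4)) *
      ∫ u in (0 : ℝ)..t', u ^ ((1 : ℝ) / 2) * (t ^ 2 - u ^ 2) ^ (-(1 / 4) : ℝ) *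
        (t' ^ 2 - u ^ 2) ^ (-(1 / 4) : ℝ) := by
  have ht : 0 < t := ht'.trans_le htt
  have hB : 0 < eulerBeta (3 / 4) (3 / 4) := eulerBeta_pos (by norm_num) (by norm_num)
  have h := mul_integral_eq (x := t' / t) (by positivity) ((div_le_one ht).mpr htt)
  have st : √t ^ 2 = t := Real.sq_sqrt ht.le
  have pt : 0 < √t := Real.sqrt_pos.mpr ht
  have e1 : √(t + t') = √t * √(1 + t' / t) := by
    rw [← Real.sqrt_mul ht.le]; congr 1; field_simp
  have e2 : √(t - t') = √t * √(1 - t' / t) := by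
    rw [← Real.sqrt_mul ht.le]; congr 1; field_simp
  rw [integral_sq_substitution ht' htt, e1, e2, ← mul_sub]
  set I := ∫ v in Set.Ioo (0 : ℝ) 1, v ^ (-(1 / 4) : ℝ) * (1 - v) ^ (-(1 / 4) : ℝ) *
    (1 - (t' / t) ^ 2 * v) ^ (-(1 / 4) : ℝ)
  have hD : √(1 + t' / t) - √(1 - t' / t) = t' / t * I / eulerBeta (3 / 4) (3 / 4) := by
    rw [h]; field_simp
  rw [hD]
  field_simp
  rw [st]

theorem itoCov_eq (t t' : ℝ) :
    itoCov t t' = (2 / eulerBeta (3 / 4) (3 / 4)) *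
      ∫ u in (0 : ℝ)..t', u ^ ((1 : ℝ) / 2) * (t ^ 2 - u ^ 2) ^ (-(1 / 4) : ℝ) *
        (t' ^ 2 - u ^ 2) ^ (-(1 / 4) : ℝ) := by
  have hB : 0 < eulerBeta (3 / 4) (3 / 4) := eulerBeta_pos (by norm_num) (by norm_num)
  rw [itoCov, ← Real.rpow_natCast, ← Real.rpow_mul (by positivity),
    show -(1 : ℝ) / 2 * (2 : ℕ) = -1 by norm_num, Real.rpow_neg_one]
  congr 1
  field_simp

/-- For `t ≥ t' > 0`,
`√(t+t') − √(t−t') = (2/B(3/4,3/4)) ∫₀^{t'} u^{1/2} (t²−u²)^{−1/4} (t'²−u²)^{−1/4} du`.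
Consequently any process whose covariance is given (via the Itô isometry) by that of
`c ∫₀^t (s^{1/4}/(t²−s²)^{1/4}) db(s)`, `c = ((1/2)B(3/4,3/4))^{−1/2}`, has the covariance
`√(t+t') − √(t−t')` of the limiting front-fluctuation process `r`. -/
theorem sqrt_covariance_beta_representation :
    (∀ t t' : ℝ, 0 < t' → t' ≤ t →
      Real.sqrt (t + t') - Real.sqrt (t - t')
        = (2 / eulerBeta (3 / 4) (3 / 4)) *
            ∫ u in (0 : ℝ)..t',
              u ^ ((1 : ℝ) / 2) * (t ^ 2 - u ^ 2) ^ (-(1 / 4) : ℝ) *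
                (t' ^ 2 - u ^ 2) ^ (-(1 / 4) : ℝ)) ∧
    (∀ (Ω : Type) [MeasureSpace Ω] [IsProbabilityMeasure (volume : Measure Ω)]
        (r : ℝ → Ω → ℝ),
      (∀ t t' : ℝ, 0 < t' → t' ≤ t → (∫ ω : Ω, r t ω * r t' ω) = itoCov t t') →
      ∀ t t' : ℝ, 0 < t' → t' ≤ t →
        (∫ ω : Ω, r t ω * r t' ω) = Real.sqrt (t + t') - Real.sqrt (t - t')) := by
  exact ⟨fun t t' ht' htt => sqrt_add_sub_sqrt_sub_eq ht' htt,
    fun Ω _ _ r hr t t' ht' htt => by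
      rw [hr t t' ht' htt, itoCov_eq, sqrt_add_sub_sqrt_sub_eq ht' htt]⟩
end

section
/- There exist δ₀ > 0 and C > 0 with the following property. For every x₀ ∈ ℝ and every continuous function m : ℝ → ℝ with sup_{x ∈ ℝ} |m(x) − tanh(x − x₀)| ≤ δ₀, there exists a unique ζ ∈ ℝ (the center of m) such that ∫_ℝ ( m(x) − tanh(x − ζ) ) sech²(x − ζ) dx = 0, and this ζ satisfies |x₀ − ζ| ≤ C · sup_{x ∈ ℝ} |m(x) − tanh(x − x₀)|. -/
open MeasureTheory Real

/-- The squared hyperbolic secant, i.e. the derivative of `tanh`. -/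
noncomputable def sechSq (x : ℝ) : ℝ := 1 / Real.cosh x ^ 2

lemma sechSq_pos (x : ℝ) : 0 < sechSq x := by
  have := Real.cosh_pos x
  unfold sechSq
  positivity

lemma continuous_sechSq : Continuous sechSq :=
  continuous_const.div (Real.continuous_cosh.pow 2) fun x => (pow_pos (Real.cosh_pos x) 2).ne'

lemma continuous_real_tanh : Continuous Real.tanh := by
  have h : Real.tanh = fun x => Real.sinh x / Real.cosh x := funext Real.tanh_eq_sinh_div_cosh
  rw [h]
  exact Real.continuous_sinh.div Real.continuous_cosh fun x => (Real.cosh_pos x).ne'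

lemma sechSq_eq_one_sub_tanh_sq (x : ℝ) : sechSq x = 1 - Real.tanh x ^ 2 := by
  have := Real.cosh_pos x
  rw [sechSq, Real.tanh_eq_sinh_div_cosh]
  field_simp
  rw [Real.cosh_sq]
  ring

lemma sechSq_le_one (x : ℝ) : sechSq x ≤ 1 := by
  rw [sechSq_eq_one_sub_tanh_sq]
  nlinarith [sq_nonneg (Real.tanh x)]

lemma sechSq_le_inv_one_add_sq (x : ℝ) : sechSq x ≤ (1 + x ^ 2)⁻¹ := by
  rw [sechSq, one_div]
  have h : |x| ≤ |Real.sinh x| := by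
    rw [Real.abs_sinh]
    exact Real.self_le_sinh_iff.2 (abs_nonneg x)
  have h' := sq_le_sq.2 h
  have := Real.cosh_sq x
  gcongr
  linarith

lemma integrable_sechSq : Integrable sechSq :=
  integrable_inv_one_add_sq.mono' continuous_sechSq.aestronglyMeasurable <| .of_forall fun x => by
    rw [Real.norm_of_nonneg (sechSq_pos x).le]
    exact sechSq_le_inv_one_add_sq x

lemma integrable_mul_sechSq_sub {f : ℝ → ℝ} (hf : Continuous f) {M : ℝ} (hM : ∀ x, |f x| ≤ M)
    (ζ : ℝ) : Integrable fun x => f x * sechSq (x - ζ) :=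
  (integrable_sechSq.comp_sub_right ζ).bdd_mul hf.aestronglyMeasurable
    (.of_forall fun x => hM x)

lemma integrable_mul_sechSq {f : ℝ → ℝ} (hf : Continuous f) {M : ℝ} (hM : ∀ x, |f x| ≤ M) :
    Integrable fun x => f x * sechSq x := by
  simpa using integrable_mul_sechSq_sub hf hM 0

lemma integral_sechSq_nonneg : 0 ≤ ∫ x, sechSq x :=
  integral_nonneg fun x => (sechSq_pos x).le

lemma integrable_sechSq_mul_sechSq : Integrable fun x => sechSq x * sechSq x :=
  integrable_mul_sechSq continuous_sechSq (M := 1) fun x => by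
    rw [abs_of_pos (sechSq_pos x)]
    exact sechSq_le_one x

lemma integral_sechSq_mul_sechSq_pos : 0 < ∫ x, sechSq x * sechSq x :=
  integral_pos_of_integrable_nonneg_nonzero (x := 0) (continuous_sechSq.mul continuous_sechSq)
    integrable_sechSq_mul_sechSq (fun x => (mul_pos (sechSq_pos x) (sechSq_pos x)).le)
    (mul_pos (sechSq_pos 0) (sechSq_pos 0)).ne'

lemma cosh_add_le (x a : ℝ) : Real.cosh (x + a) ≤ Real.cosh x * Real.exp |a| := by
  rw [Real.cosh_eq, Real.cosh_eq, neg_add, Real.exp_add, Real.exp_add]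
  have h₁ : Real.exp a ≤ Real.exp |a| := Real.exp_le_exp.2 (le_abs_self a)
  have h₂ : Real.exp (-a) ≤ Real.exp |a| := Real.exp_le_exp.2 (neg_le_abs a)
  nlinarith [Real.exp_pos x, Real.exp_pos (-x)]

lemma tanh_add_sub_tanh (y h : ℝ) :
    Real.tanh (y + h) - Real.tanh y = Real.sinh h / (Real.cosh y * Real.cosh (y + h)) := by
  have h₁ := (Real.cosh_pos y).ne'
  have h₂ := (Real.cosh_pos (y + h)).ne'
  have h₃ : Real.sinh h = Real.sinh (y + h) * Real.cosh y - Real.cosh (y + h) * Real.sinh y := by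
    rw [← Real.sinh_sub]
    congr 1
    ring
  rw [Real.tanh_eq_sinh_div_cosh, Real.tanh_eq_sinh_div_cosh, h₃]
  field_simp

lemma tanh_le_tanh_of_le {y z : ℝ} (h : y ≤ z) : Real.tanh y ≤ Real.tanh z := by
  have h₁ := tanh_add_sub_tanh y (z - y)
  have h₂ : 0 ≤ Real.sinh (z - y) := Real.sinh_nonneg_iff.2 (sub_nonneg.2 h)
  have h₃ := Real.cosh_pos y
  have h₄ := Real.cosh_pos (y + (z - y))
  have h₅ : 0 ≤ Real.sinh (z - y) / (Real.cosh y * Real.cosh (y + (z - y))) := by positivity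
  rw [add_sub_cancel] at h₁ h₅
  linarith

lemma sinh_le_mul_exp (h : ℝ) : Real.sinh h ≤ h * Real.exp h := by
  have h₁ := Real.add_one_le_exp (-(2 * h))
  have h₂ : Real.exp (-h) = Real.exp h * Real.exp (-(2 * h)) := by
    rw [← Real.exp_add]
    congr 1
    ring
  rw [Real.sinh_eq, h₂]
  nlinarith [Real.exp_pos h]

lemma tanh_add_sub_tanh_le {h : ℝ} (h₀ : 0 ≤ h) (h₂ : h ≤ 2) (y : ℝ) :
    Real.tanh (y + h) - Real.tanh y ≤ h * Real.exp 4 * sechSq y := by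
  have hy := Real.cosh_pos y
  have hyh := Real.cosh_pos (y + h)
  have h₁ := cosh_add_le (y + h) (-h)
  rw [add_neg_cancel_right, abs_neg, abs_of_nonneg h₀] at h₁
  have he : Real.exp h * Real.exp h ≤ Real.exp 4 := by
    rw [← Real.exp_add]
    exact Real.exp_le_exp.2 (by linarith)
  rw [tanh_add_sub_tanh, sechSq, mul_one_div, div_le_div_iff₀ (by positivity) (by positivity)]
  calc Real.sinh h * Real.cosh y ^ 2
      = Real.sinh h * (Real.cosh y * Real.cosh y) := by ring
    _ ≤ (h * Real.exp h) * (Real.cosh y * (Real.cosh (y + h) * Real.exp h)) := by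
        gcongr
        exact sinh_le_mul_exp h
    _ = h * (Real.exp h * Real.exp h) * (Real.cosh y * Real.cosh (y + h)) := by ring
    _ ≤ h * Real.exp 4 * (Real.cosh y * Real.cosh (y + h)) := by gcongr

lemma le_tanh_add_sub_tanh_add {a b : ℝ} (ha : |a| ≤ 1) (hb : |b| ≤ 1) (hab : a ≤ b) (x : ℝ) :
    (b - a) * Real.exp (-2) * sechSq x ≤ Real.tanh (x + b) - Real.tanh (x + a) := by
  have h := tanh_add_sub_tanh (x + a) (b - a)
  rw [show x + a + (b - a) = x + b by ring] at h
  have hx := Real.cosh_pos x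
  have hxa := Real.cosh_pos (x + a)
  have hxb := Real.cosh_pos (x + b)
  have bound : ∀ c, |c| ≤ 1 → Real.cosh (x + c) ≤ Real.cosh x * Real.exp 1 := fun c hc =>
    (cosh_add_le x c).trans (by gcongr)
  have he : Real.exp (-2) * (Real.exp 1 * Real.exp 1) = 1 := by
    rw [← Real.exp_add, ← Real.exp_add]
    norm_num
  have hba : 0 ≤ b - a := sub_nonneg.2 hab
  rw [h, sechSq, mul_one_div, div_le_div_iff₀ (by positivity) (by positivity)]
  calc (b - a) * Real.exp (-2) * (Real.cosh (x + a) * Real.cosh (x + b))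
      ≤ (b - a) * Real.exp (-2) * ((Real.cosh x * Real.exp 1) * (Real.cosh x * Real.exp 1)) := by
        gcongr
        · exact bound a ha
        · exact bound b hb
    _ = (b - a) * (Real.exp (-2) * (Real.exp 1 * Real.exp 1)) * Real.cosh x ^ 2 := by ring
    _ = (b - a) * Real.cosh x ^ 2 := by rw [he, mul_one]
    _ ≤ Real.sinh (b - a) * Real.cosh x ^ 2 := by
        gcongr
        exact Real.self_le_sinh_iff.2 hba

lemma abs_sechSq_add_sub_sechSq_le {h : ℝ} (h₀ : 0 ≤ h) (h₂ : h ≤ 2) (y : ℝ) :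
    |sechSq (y + h) - sechSq y| ≤ 2 * (h * Real.exp 4 * sechSq y) := by
  have hle := tanh_add_sub_tanh_le h₀ h₂ y
  have hnn : 0 ≤ Real.tanh (y + h) - Real.tanh y :=
    sub_nonneg.2 (tanh_le_tanh_of_le (le_add_of_nonneg_right h₀))
  have hsum : |-(Real.tanh (y + h) + Real.tanh y)| ≤ 2 := by
    rw [abs_neg]
    linarith [abs_add_le (Real.tanh (y + h)) (Real.tanh y), Real.abs_tanh_lt_one (y + h),
      Real.abs_tanh_lt_one y]
  rw [sechSq_eq_one_sub_tanh_sq, sechSq_eq_one_sub_tanh_sq y,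
    show 1 - Real.tanh (y + h) ^ 2 - (1 - Real.tanh y ^ 2)
      = -(Real.tanh (y + h) + Real.tanh y) * (Real.tanh (y + h) - Real.tanh y) by ring,
    abs_mul, abs_of_nonneg hnn, ← sechSq_eq_one_sub_tanh_sq]
  gcongr

/-- The pairing of the shifted kink, relative to the unshifted one, with `sech²`. -/
noncomputable def kinkPairing (a : ℝ) : ℝ := ∫ x, (Real.tanh (x + a) - Real.tanh x) * sechSq x

lemma abs_tanh_sub_tanh_le (x y : ℝ) : |Real.tanh x - Real.tanh y| ≤ 2 := by
  linarith [abs_sub (Real.tanh x) (Real.tanh y), Real.abs_tanh_lt_one x, Real.abs_tanh_lt_one y]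

lemma integrable_kinkPairing (a : ℝ) :
    Integrable fun x => (Real.tanh (x + a) - Real.tanh x) * sechSq x :=
  integrable_mul_sechSq
    ((continuous_real_tanh.comp (continuous_id.add continuous_const)).sub continuous_real_tanh)
    fun x => abs_tanh_sub_tanh_le (x + a) x

lemma kinkPairing_zero : kinkPairing 0 = 0 := by simp [kinkPairing]

lemma kinkPairing_mono : Monotone kinkPairing := fun a b hab =>
  integral_mono (integrable_kinkPairing a) (integrable_kinkPairing b) fun x =>
    mul_le_mul_of_nonneg_right
      (sub_le_sub_right (tanh_le_tanh_of_le (add_le_add_right hab x)) _) (sechSq_pos x).le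

lemma le_kinkPairing_sub {a b : ℝ} (ha : |a| ≤ 1) (hb : |b| ≤ 1) (hab : a ≤ b) :
    (b - a) * (Real.exp (-2) * ∫ x, sechSq x * sechSq x) ≤ kinkPairing b - kinkPairing a := by
  rw [kinkPairing, kinkPairing, ← integral_sub (integrable_kinkPairing b)
    (integrable_kinkPairing a), ← mul_assoc, ← integral_const_mul]
  refine integral_mono (integrable_sechSq_mul_sechSq.const_mul _)
    ((integrable_kinkPairing b).sub (integrable_kinkPairing a)) fun x => ?_
  have := mul_le_mul_of_nonneg_right (le_tanh_add_sub_tanh_add ha hb hab x) (sechSq_pos x).le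
  simp only
  linarith

lemma abs_integral_mul_sechSq_sub_le {e : ℝ → ℝ} {δ : ℝ} (he : ∀ x, |e x| ≤ δ) (ζ : ℝ) :
    |∫ x, e x * sechSq (x - ζ)| ≤ δ * ∫ x, sechSq x := by
  rw [← integral_sub_right_eq_self sechSq ζ, ← integral_const_mul, ← Real.norm_eq_abs]
  refine norm_integral_le_of_norm_le ((integrable_sechSq.comp_sub_right ζ).const_mul δ)
    (.of_forall fun x => ?_)
  rw [Real.norm_eq_abs, abs_mul, abs_of_pos (sechSq_pos _)]
  exact mul_le_mul_of_nonneg_right (he x) (sechSq_pos _).le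

lemma abs_integral_mul_sechSq_sub_sub_le {e : ℝ → ℝ} (hc : Continuous e) {δ : ℝ}
    (he : ∀ x, |e x| ≤ δ) {ζ ζ' : ℝ} (h₀ : ζ ≤ ζ') (h₂ : ζ' - ζ ≤ 2) :
    |(∫ x, e x * sechSq (x - ζ)) - ∫ x, e x * sechSq (x - ζ')|
      ≤ δ * (2 * Real.exp 4 * ∫ x, sechSq x) * (ζ' - ζ) := by
  have hδ : 0 ≤ δ := (abs_nonneg _).trans (he 0)
  rw [← integral_sub (integrable_mul_sechSq_sub hc he ζ) (integrable_mul_sechSq_sub hc he ζ'),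
    ← integral_sub_right_eq_self sechSq ζ', ← integral_const_mul, ← integral_const_mul,
    ← integral_mul_const, ← Real.norm_eq_abs]
  refine norm_integral_le_of_norm_le
    ((((integrable_sechSq.comp_sub_right ζ').const_mul _).const_mul _).mul_const _)
    (.of_forall fun x => ?_)
  have h := abs_sechSq_add_sub_sechSq_le (sub_nonneg.2 h₀) h₂ (x - ζ')
  rw [show x - ζ' + (ζ' - ζ) = x - ζ by ring] at h
  rw [Real.norm_eq_abs, ← mul_sub, abs_mul]
  calc |e x| * |sechSq (x - ζ) - sechSq (x - ζ')|
      ≤ δ * (2 * ((ζ' - ζ) * Real.exp 4 * sechSq (x - ζ'))) := by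
        gcongr
        exact he x
    _ = δ * (2 * Real.exp 4 * sechSq (x - ζ')) * (ζ' - ζ) := by ring

/-- The pairing whose zero defines the center of `m`. -/
noncomputable def centerPairing (m : ℝ → ℝ) (ζ : ℝ) : ℝ :=
  ∫ x, (m x - Real.tanh (x - ζ)) * sechSq (x - ζ)

lemma centerPairing_eq {m : ℝ → ℝ} (hm : Continuous m) {x₀ δ : ℝ}
    (h : ∀ x, |m x - Real.tanh (x - x₀)| ≤ δ) (ζ : ℝ) :
    centerPairing m ζ = kinkPairing (ζ - x₀)
      + ∫ x, (m x - Real.tanh (x - x₀)) * sechSq (x - ζ) := by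
  have ht : ∀ c : ℝ, Continuous fun x => Real.tanh (x - c) := fun c =>
    continuous_real_tanh.comp (continuous_id.sub continuous_const)
  have h₁ : kinkPairing (ζ - x₀)
      = ∫ x, (Real.tanh (x - x₀) - Real.tanh (x - ζ)) * sechSq (x - ζ) := by
    rw [kinkPairing, ← integral_sub_right_eq_self _ ζ]
    simp only [sub_add_sub_cancel]
  have i₁ : Integrable fun x => (Real.tanh (x - x₀) - Real.tanh (x - ζ)) * sechSq (x - ζ) :=
    integrable_mul_sechSq_sub ((ht x₀).sub (ht ζ)) (fun x => abs_tanh_sub_tanh_le _ _) ζ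
  have i₂ : Integrable fun x => (m x - Real.tanh (x - x₀)) * sechSq (x - ζ) :=
    integrable_mul_sechSq_sub (hm.sub (ht x₀)) h ζ
  rw [h₁, centerPairing, ← integral_add i₁ i₂]
  congr 1
  ext x
  ring

lemma continuous_centerPairing {m : ℝ → ℝ} (hm : Continuous m) {M : ℝ} (hM : ∀ x, |m x| ≤ M) :
    Continuous (centerPairing m) := by
  have h : centerPairing m = fun ζ => ∫ x, (m (x + ζ) - Real.tanh x) * sechSq x := by
    ext ζ
    rw [centerPairing, ← integral_sub_right_eq_self (fun x => (m (x + ζ) - _) * _) ζ]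
    simp only [sub_add_cancel]
  rw [h]
  refine continuous_of_dominated (bound := fun x => (M + 1) * sechSq x) (fun ζ => ?_)
    (fun ζ => .of_forall fun x => ?_) (integrable_sechSq.const_mul _) (.of_forall fun x => ?_)
  · exact (((hm.comp (continuous_id.add continuous_const)).sub continuous_real_tanh).mul
      continuous_sechSq).aestronglyMeasurable
  · rw [Real.norm_eq_abs, abs_mul, abs_of_pos (sechSq_pos x)]
    refine mul_le_mul_of_nonneg_right ?_ (sechSq_pos x).le
    linarith [abs_sub (m (x + ζ)) (Real.tanh x), hM (x + ζ), Real.abs_tanh_lt_one x]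
  · exact ((hm.comp (continuous_const.add continuous_id)).sub continuous_const).mul
      continuous_const

/-- Existence and uniqueness of the center of a front: there are `δ₀ > 0` and `C > 0` such
that every continuous `m` with `sup_x |m(x) − tanh(x − x₀)| ≤ δ ≤ δ₀` has a unique center,
i.e. a unique `ζ` with `∫ (m(x) − tanh(x−ζ)) sech²(x−ζ) dx = 0`, and this center satisfies
`|x₀ − ζ| ≤ C δ`. -/
theorem center_exists_unique :
    ∃ δ₀ > (0 : ℝ), ∃ C > (0 : ℝ),
      ∀ (x₀ : ℝ) (m : ℝ → ℝ) (δ : ℝ), Continuous m → δ ≤ δ₀ →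
        (∀ x : ℝ, |m x - Real.tanh (x - x₀)| ≤ δ) →
        ∃ ζ : ℝ,
          (∫ x : ℝ, (m x - Real.tanh (x - ζ)) * (1 / Real.cosh (x - ζ) ^ 2)) = 0 ∧
          |x₀ - ζ| ≤ C * δ ∧
          ∀ ζ' : ℝ,
            (∫ x : ℝ, (m x - Real.tanh (x - ζ')) * (1 / Real.cosh (x - ζ') ^ 2)) = 0 →
            ζ' = ζ := by
  have hA := integral_sechSq_nonneg
  have hc : 0 < Real.exp (-2) * ∫ x, sechSq x * sechSq x :=
    mul_pos (Real.exp_pos _) integral_sechSq_mul_sechSq_pos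
  have hgap := @le_kinkPairing_sub
  have hsmall := @abs_integral_mul_sechSq_sub_le
  have hlip := @abs_integral_mul_sechSq_sub_sub_le
  have hK : 0 ≤ 2 * Real.exp 4 * ∫ x, sechSq x := by positivity
  set A := ∫ x, sechSq x
  set K := 2 * Real.exp 4 * A
  set c := Real.exp (-2) * ∫ x, sechSq x * sechSq x
  refine ⟨c / (2 * (A + K + 1)), by positivity, A / c + 1, by positivity, ?_⟩
  intro x₀ m δ hm hδ h
  have hδ₀ : 0 ≤ δ := (abs_nonneg _).trans (h 0)
  rw [le_div_iff₀ (by positivity)] at hδ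
  have hδA : δ * A < c := by nlinarith [mul_nonneg hδ₀ hA, mul_nonneg hδ₀ hK]
  have hδK : δ * K < c := by nlinarith [mul_nonneg hδ₀ hA, mul_nonneg hδ₀ hK]
  have hec : Continuous fun x => m x - Real.tanh (x - x₀) :=
    hm.sub (continuous_real_tanh.comp (continuous_id.sub continuous_const))
  have hF := centerPairing_eq hm h
  have hP := fun ζ => abs_le.1 (hsmall h ζ)
  have h1 : c ≤ kinkPairing 1 := by
    have := hgap (a := 0) (b := 1) (by simp) (by simp) zero_le_one
    rw [kinkPairing_zero] at this
    linarith
  have h2 : kinkPairing (-1) ≤ -c := by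
    have := hgap (a := -1) (b := 0) (by simp) (by simp) (by norm_num)
    rw [kinkPairing_zero] at this
    linarith
  have hM : ∀ x, |m x| ≤ δ + 1 := fun x => by
    have := abs_sub_abs_le_abs_sub (m x) (Real.tanh (x - x₀))
    linarith [h x, Real.abs_tanh_lt_one (x - x₀)]
  have hloc : ∀ ζ, centerPairing m ζ = 0 → |ζ - x₀| ≤ 1 := by
    intro ζ hζ
    rw [hF] at hζ
    by_contra! hlt
    rcases lt_abs.1 hlt with hlt | hlt
    · linarith [kinkPairing_mono hlt.le, (hP ζ).1]
    · linarith [kinkPairing_mono (le_neg_of_le_neg hlt.le), (hP ζ).2]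
  have huniq : ∀ ζ ζ', ζ ≤ ζ' → centerPairing m ζ = 0 → centerPairing m ζ' = 0 → ζ' ≤ ζ := by
    intro ζ ζ' hle hζ hζ'
    have hl := hloc ζ hζ
    have hl' := hloc ζ' hζ'
    have hg := hgap hl hl' (by linarith)
    have hp := hlip hec h hle (by linarith [(abs_le.1 hl).1, (abs_le.1 hl').2])
    rw [hF] at hζ hζ'
    have hp' := (abs_le.1 hp).2
    by_contra! hlt
    have := mul_lt_mul_of_pos_right hδK (sub_pos.2 hlt)
    linarith
  obtain ⟨ζ, -, hζ⟩ : (0 : ℝ) ∈ centerPairing m '' Set.Icc (x₀ - 1) (x₀ + 1) := by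
    refine intermediate_value_Icc (by linarith) (continuous_centerPairing hm hM).continuousOn
      ⟨?_, ?_⟩
    · rw [hF, sub_sub_cancel_left]
      linarith [(hP (x₀ - 1)).2]
    · rw [hF, add_sub_cancel_left]
      linarith [(hP (x₀ + 1)).1]
  refine ⟨ζ, hζ, ?_, fun ζ' hζ' => ?_⟩
  · have hl := hloc ζ hζ
    have hPζ := hP ζ
    rw [hF] at hζ
    have key : |ζ - x₀| * c ≤ δ * A := by
      rcases le_total 0 (ζ - x₀) with hs | hs
      · have := hgap (a := 0) (by simp) hl hs
        rw [kinkPairing_zero] at this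
        rw [abs_of_nonneg hs]
        linarith [hPζ.1]
      · have := hgap (b := 0) hl (by simp) hs
        rw [kinkPairing_zero] at this
        rw [abs_of_nonpos hs]
        linarith [hPζ.2]
    rw [abs_sub_comm]
    calc |ζ - x₀| ≤ δ * A / c := (le_div_iff₀ hc).2 key
      _ = A / c * δ := by ring
      _ ≤ (A / c + 1) * δ := by gcongr; linarith
  · rcases le_total ζ ζ' with hle | hle
    · exact le_antisymm (huniq ζ ζ' hle hζ hζ') hle
    · exact le_antisymm hle (huniq ζ' ζ hle hζ' hζ)
end

section
/- Let D(x,y,t) = (1/√(2πt)) { −(1/2) m̄'(x) m̄'(y) + m̄'(x) (y/(8t)) e^{−y²/(8t)} sign(y) + (x/(8t)) e^{−x²/(8t)} m̄'(y) sign(x) + (1/(4t)) e^{−(x+y)²/(8t)} 𝟙_{sign(xy)=1} − ((x+y)²/(16t²)) e^{−(x+y)²/(8t)} 𝟙_{sign(xy)=1} }, where m̄'(x) = sech²(x). Then for every t₀ > 0 there exists a constant C > 0 such that for all T ≥ t₀, sup_{x ∈ ℝ} ∫_{t₀}^{T} dt ∫_ℝ dy |D(x,y,t)| ≤ C √T.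 -/
open MeasureTheory Real

/-- `m̄'(x) = sech²(x)`, the derivative of the kink `m̄(x) = tanh(x)`. -/
noncomputable def mbar' (x : ℝ) : ℝ := 1 / Real.cosh x ^ 2

/-- The mixed derivative `D(x,y,t) = ∂_x ∂_y K*(x,y,t)` of the long-time part of the
Green function `K` of `e^{−t ∂_x L ∂_x}`; the indicator `𝟙_{sign(xy)=1}` is rendered as
`if 0 < x*y then 1 else 0`. -/
noncomputable def D (x y t : ℝ) : ℝ :=
  (1 / Real.sqrt (2 * Real.pi * t)) *
    (-(1 / 2) * mbar' x * mbar' y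
      + mbar' x * (y / (8 * t)) * Real.exp (-(y ^ 2) / (8 * t)) * Real.sign y
      + (x / (8 * t)) * Real.exp (-(x ^ 2) / (8 * t)) * mbar' y * Real.sign x
      + (1 / (4 * t)) * Real.exp (-((x + y) ^ 2) / (8 * t))
          * (if 0 < x * y then (1 : ℝ) else 0)
      - ((x + y) ^ 2 / (16 * t ^ 2)) * Real.exp (-((x + y) ^ 2) / (8 * t))
          * (if 0 < x * y then (1 : ℝ) else 0))

lemma mbar'_nonneg (x : ℝ) : 0 ≤ mbar' x := by
  unfold mbar'; positivity

lemma mbar'_le_inv_one_add_sq (x : ℝ) : mbar' x ≤ (1 + x ^ 2)⁻¹ := by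
  unfold mbar'
  rw [one_div]
  apply inv_anti₀ (by positivity)
  nlinarith [Real.cosh_sq x, Real.self_le_sinh_iff.2 (abs_nonneg x), Real.abs_sinh x,
    sq_abs x, sq_abs (Real.sinh x), abs_nonneg x]

lemma mbar'_le_one (x : ℝ) : mbar' x ≤ 1 :=
  (mbar'_le_inv_one_add_sq x).trans (inv_le_one_of_one_le₀ (by nlinarith [sq_nonneg x]))

lemma exp_neg_sq_div_eight_eq (z s : ℝ) :
    exp (-(z ^ 2) / (8 * s ^ 2)) =
      exp (-(1 / (16 * s ^ 2)) * z ^ 2) * exp (-(1 / (16 * s ^ 2)) * z ^ 2) := by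
  rw [← Real.exp_add]
  congr 1
  ring

lemma one_add_mul_exp_neg_le_one (u : ℝ) : (1 + u) * exp (-u) ≤ 1 := by
  have h := mul_le_mul_of_nonneg_right (Real.add_one_le_exp u) (exp_pos (-u)).le
  rw [← Real.exp_add, add_neg_cancel, Real.exp_zero] at h
  linarith

lemma exp_neg_sq_div_eight_le (z s : ℝ) :
    exp (-(z ^ 2) / (8 * s ^ 2)) ≤ exp (-(1 / (16 * s ^ 2)) * z ^ 2) := by
  rw [exp_neg_sq_div_eight_eq]
  apply mul_le_of_le_one_left (exp_pos _).le
  rw [Real.exp_le_one_iff]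
  have : 0 ≤ 1 / (16 * s ^ 2) * z ^ 2 := by positivity
  linarith

/-- A Gaussian absorbs a linear factor, at the cost of doubling its variance. -/
lemma abs_mul_exp_neg_sq_le (z s : ℝ) (hs : 0 < s) :
    |z| / (8 * s ^ 2) * exp (-(z ^ 2) / (8 * s ^ 2)) ≤
      1 / s * exp (-(1 / (16 * s ^ 2)) * z ^ 2) := by
  rw [exp_neg_sq_div_eight_eq, ← mul_assoc]
  apply mul_le_mul_of_nonneg_right _ (exp_pos _).le
  have h := one_add_mul_exp_neg_le_one (1 / (16 * s ^ 2) * z ^ 2)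
  rw [← neg_mul] at h
  have hle : |z| / (8 * s ^ 2) ≤ 1 / s * (1 + 1 / (16 * s ^ 2) * z ^ 2) := by
    rw [← sq_abs z]
    have : 1 / s * (1 + 1 / (16 * s ^ 2) * |z| ^ 2) - |z| / (8 * s ^ 2)
        = ((|z| - s) ^ 2 + 15 * s ^ 2) / (16 * s ^ 3) := by
      field_simp
      ring
    have : 0 ≤ ((|z| - s) ^ 2 + 15 * s ^ 2) / (16 * s ^ 3) := by positivity
    linarith
  calc _ ≤ 1 / s * (1 + 1 / (16 * s ^ 2) * z ^ 2) * exp (-(1 / (16 * s ^ 2)) * z ^ 2) :=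
        mul_le_mul_of_nonneg_right hle (exp_pos _).le
    _ ≤ 1 / s * 1 := by
        rw [mul_assoc]
        exact mul_le_mul_of_nonneg_left h (by positivity)
    _ = 1 / s := mul_one _

/-- A Gaussian absorbs a quadratic factor, at the cost of doubling its variance. -/
lemma sq_mul_exp_neg_sq_le (z s : ℝ) (hs : 0 < s) :
    z ^ 2 / (16 * (s ^ 2) ^ 2) * exp (-(z ^ 2) / (8 * s ^ 2)) ≤
      1 / s ^ 2 * exp (-(1 / (16 * s ^ 2)) * z ^ 2) := by
  rw [exp_neg_sq_div_eight_eq, ← mul_assoc]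
  apply mul_le_mul_of_nonneg_right _ (exp_pos _).le
  have h := one_add_mul_exp_neg_le_one (1 / (16 * s ^ 2) * z ^ 2)
  rw [← neg_mul] at h
  have he := exp_pos (-(1 / (16 * s ^ 2)) * z ^ 2)
  have : z ^ 2 / (16 * (s ^ 2) ^ 2) = 1 / s ^ 2 * (1 / (16 * s ^ 2) * z ^ 2) := by
    field_simp
  rw [this, mul_assoc]
  calc _ ≤ 1 / s ^ 2 * 1 := mul_le_mul_of_nonneg_left (by linarith) (by positivity)
    _ = _ := mul_one _

lemma abs_sign_le_one (x : ℝ) : |Real.sign x| ≤ 1 := by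
  rcases Real.sign_apply_eq x with h | h | h <;> simp [h]

lemma one_div_sqrt_two_pi_le (s : ℝ) (hs : 0 < s) :
    1 / √(2 * π * s ^ 2) ≤ 1 / s := by
  apply one_div_le_one_div_of_le hs
  apply Real.le_sqrt_of_sq_le
  nlinarith [Real.pi_gt_three, sq_nonneg s]

lemma abs_D_le (x y s : ℝ) (hs : 0 < s) :
    |D x y (s ^ 2)| ≤ 1 / s *
      ((1 / 2 + 1 / s) * (1 + y ^ 2)⁻¹ + 1 / s * exp (-(1 / (16 * s ^ 2)) * y ^ 2)
        + 5 / (4 * s ^ 2) * exp (-(1 / (16 * s ^ 2)) * (x + y) ^ 2)) := by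
  unfold D
  rw [abs_mul, abs_of_nonneg (by positivity : 0 ≤ 1 / √(2 * π * s ^ 2))]
  refine mul_le_mul (one_div_sqrt_two_pi_le s hs) ?_ (abs_nonneg _) (by positivity)
  have hχ : |(if 0 < x * y then (1 : ℝ) else 0)| ≤ 1 := by split_ifs <;> simp
  generalize (if 0 < x * y then (1 : ℝ) else 0) = χ at hχ ⊢
  have hmx := mbar'_le_one x
  have hmx0 := mbar'_nonneg x
  have hmy := mbar'_le_inv_one_add_sq y
  have hmy0 := mbar'_nonneg y
  have h1 : |-(1 / 2) * mbar' x * mbar' y| ≤ 1 / 2 * (1 + y ^ 2)⁻¹ := by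
    rw [abs_mul, abs_mul, abs_of_nonneg hmx0, abs_of_nonneg hmy0, abs_neg,
      abs_of_nonneg (by norm_num : (0 : ℝ) ≤ 1 / 2)]
    nlinarith
  have h2 : |mbar' x * (y / (8 * s ^ 2)) * exp (-(y ^ 2) / (8 * s ^ 2)) * Real.sign y|
      ≤ 1 / s * exp (-(1 / (16 * s ^ 2)) * y ^ 2) := by
    rw [abs_mul, abs_mul, abs_mul, abs_of_nonneg hmx0, abs_div, Real.abs_exp,
      abs_of_pos (by positivity : 0 < 8 * s ^ 2), mul_assoc (mbar' x)]
    refine (mul_le_of_le_one_right (by positivity) (abs_sign_le_one y)).trans ?_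
    exact (mul_le_of_le_one_left (by positivity) hmx).trans (abs_mul_exp_neg_sq_le y s hs)
  have h3 : |x / (8 * s ^ 2) * exp (-(x ^ 2) / (8 * s ^ 2)) * mbar' y * Real.sign x|
      ≤ 1 / s * (1 + y ^ 2)⁻¹ := by
    rw [abs_mul, abs_mul, abs_mul, abs_of_nonneg hmy0, abs_div, Real.abs_exp,
      abs_of_pos (by positivity : 0 < 8 * s ^ 2)]
    refine (mul_le_of_le_one_right (by positivity) (abs_sign_le_one x)).trans ?_
    refine mul_le_mul ((abs_mul_exp_neg_sq_le x s hs).trans ?_) hmy hmy0 (by positivity)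
    apply mul_le_of_le_one_right (by positivity)
    rw [Real.exp_le_one_iff, neg_mul]
    exact neg_nonpos.2 (by positivity)
  have h4 : |1 / (4 * s ^ 2) * exp (-((x + y) ^ 2) / (8 * s ^ 2)) * χ|
      ≤ 1 / (4 * s ^ 2) * exp (-(1 / (16 * s ^ 2)) * (x + y) ^ 2) := by
    rw [abs_mul, abs_of_pos (by positivity :
      0 < 1 / (4 * s ^ 2) * exp (-((x + y) ^ 2) / (8 * s ^ 2)))]
    refine (mul_le_of_le_one_right (by positivity) hχ).trans ?_
    exact mul_le_mul_of_nonneg_left (exp_neg_sq_div_eight_le _ _) (by positivity)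
  have h5 : |(x + y) ^ 2 / (16 * (s ^ 2) ^ 2) * exp (-((x + y) ^ 2) / (8 * s ^ 2)) * χ|
      ≤ 1 / s ^ 2 * exp (-(1 / (16 * s ^ 2)) * (x + y) ^ 2) := by
    rw [abs_mul, abs_of_nonneg (by positivity :
      0 ≤ (x + y) ^ 2 / (16 * (s ^ 2) ^ 2) * exp (-((x + y) ^ 2) / (8 * s ^ 2)))]
    exact (mul_le_of_le_one_right (by positivity) hχ).trans (sq_mul_exp_neg_sq_le _ s hs)
  have h5' : 5 / (4 * s ^ 2) * exp (-(1 / (16 * s ^ 2)) * (x + y) ^ 2) =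
      1 / (4 * s ^ 2) * exp (-(1 / (16 * s ^ 2)) * (x + y) ^ 2)
        + 1 / s ^ 2 * exp (-(1 / (16 * s ^ 2)) * (x + y) ^ 2) := by
    field_simp
    ring
  refine (abs_sub _ _).trans ?_
  refine (add_le_add_left ((abs_add_le _ _).trans (add_le_add_left ((abs_add_le _ _).trans
    (add_le_add_left (abs_add_le _ _) _)) _)) _).trans ?_
  linarith

lemma integral_exp_neg_sq_div_sixteen (s : ℝ) (hs : 0 < s) :
    ∫ y : ℝ, exp (-(1 / (16 * s ^ 2)) * y ^ 2) = 4 * s * √π := by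
  rw [integral_gaussian, div_div_eq_mul_div, div_one, mul_comm π,
    Real.sqrt_mul (by positivity), show 16 * s ^ 2 = (4 * s) ^ 2 by ring,
    Real.sqrt_sq (by positivity)]

lemma integral_abs_D_le (x s : ℝ) (hs : 0 < s) :
    ∫ y : ℝ, |D x y (s ^ 2)| ≤
      1 / s * ((1 / 2 + 1 / s) * π + 4 * √π + 5 / s * √π) := by
  have hg : Integrable fun y : ℝ => exp (-(1 / (16 * s ^ 2)) * y ^ 2) :=
    integrable_exp_neg_mul_sq (by positivity)
  have hgx : Integrable fun y : ℝ => exp (-(1 / (16 * s ^ 2)) * (x + y) ^ 2) :=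
    hg.comp_add_left x
  have i1 : Integrable fun y : ℝ => (1 / 2 + 1 / s) * (1 + y ^ 2)⁻¹ :=
    integrable_inv_one_add_sq.const_mul _
  have i2 := hg.const_mul (1 / s)
  have i3 := hgx.const_mul (5 / (4 * s ^ 2))
  calc ∫ y : ℝ, |D x y (s ^ 2)| ≤ ∫ y : ℝ, 1 / s *
      ((1 / 2 + 1 / s) * (1 + y ^ 2)⁻¹ + 1 / s * exp (-(1 / (16 * s ^ 2)) * y ^ 2)
        + 5 / (4 * s ^ 2) * exp (-(1 / (16 * s ^ 2)) * (x + y) ^ 2)) :=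
        integral_mono_of_nonneg (Filter.Eventually.of_forall fun y => abs_nonneg _)
          (((i1.add i2).add i3).const_mul _)
          (Filter.Eventually.of_forall fun y => abs_D_le x y s hs)
    _ = 1 / s * ((1 / 2 + 1 / s) * π + 4 * √π + 5 / s * √π) := by
        have hshift : ∫ y : ℝ, exp (-(1 / (16 * s ^ 2)) * (x + y) ^ 2) = 4 * s * √π := by
          rw [← integral_exp_neg_sq_div_sixteen s hs]
          exact integral_add_left_eq_self
            (fun y : ℝ => exp (-(1 / (16 * s ^ 2)) * y ^ 2)) x
        rw [integral_const_mul, integral_add (by exact i1.add i2) i3, integral_add i1 i2,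
          integral_const_mul, integral_const_mul, integral_const_mul, hshift,
          integral_exp_neg_sq_div_sixteen s hs, integral_univ_inv_one_add_sq]
        field_simp

/-- For every `t₀ > 0` there is `C > 0` such that for all `T ≥ t₀`,
`sup_x ∫_{t₀}^{T} ∫_ℝ |D(x,y,t)| dy dt ≤ C √T`. -/
theorem Kstar_mixed_derivative_L1_bound (t₀ : ℝ) (ht₀ : 0 < t₀) :
    ∃ C > (0 : ℝ), ∀ T : ℝ, t₀ ≤ T → ∀ x : ℝ,
      (∫ t in t₀..T, ∫ y : ℝ, |D x y t|) ≤ C * Real.sqrt T := by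
  have hs₀ : 0 < √t₀ := Real.sqrt_pos.2 ht₀
  set A : ℝ := (1 / 2 + 1 / √t₀) * π + 4 * √π + 5 / √t₀ * √π with hA
  have hApos : 0 < A := by positivity
  refine ⟨2 * A, by positivity, fun T hT x => ?_⟩
  have hpos : ∀ t ∈ Set.uIcc t₀ T, 0 < t := fun t ht => by
    rw [Set.uIcc_of_le hT] at ht
    exact ht₀.trans_le ht.1
  have hint : IntervalIntegrable (fun t => A * (1 / √t)) volume t₀ T := by
    apply ContinuousOn.intervalIntegrable
    exact continuousOn_const.mul (continuousOn_const.div Real.continuous_sqrt.continuousOn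
      fun t ht => (Real.sqrt_pos.2 (hpos t ht)).ne')
  have hbound : ∀ t ∈ Set.Ioc t₀ T, ‖∫ y : ℝ, |D x y t|‖ ≤ A * (1 / √t) := fun t ht => by
    have ht0 : 0 < t := ht₀.trans ht.1
    have hs : 0 < √t := Real.sqrt_pos.2 ht0
    have hle : √t₀ ≤ √t := Real.sqrt_le_sqrt ht.1.le
    rw [Real.norm_of_nonneg (integral_nonneg fun y => abs_nonneg _)]
    have h := integral_abs_D_le x (√t) hs
    rw [Real.sq_sqrt ht0.le] at h
    refine h.trans ?_
    rw [mul_comm, hA]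
    gcongr
  have hle := intervalIntegral.norm_integral_le_of_norm_le hT
    (Filter.Eventually.of_forall hbound) hint
  refine (Real.le_norm_self _).trans (hle.trans ?_)
  have hderiv : ∀ t ∈ Set.uIcc t₀ T,
      HasDerivAt (fun t => 2 * A * √t) (A * (1 / √t)) t := fun t ht => by
    have hs : 0 < √t := Real.sqrt_pos.2 (hpos t ht)
    have heq : A * (1 / √t) = 2 * A * (1 / (2 * √t)) := by field_simp
    rw [heq]
    exact (Real.hasDerivAt_sqrt (hpos t ht).ne').const_mul (2 * A)
  rw [intervalIntegral.integral_eq_sub_of_hasDerivAt hderiv hint]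
  have : 0 ≤ 2 * A * √t₀ := by positivity
  linarith
end
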